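/- Fix λ ∈ (0,1/2), a cutoff ζ, γ ∈ [0,1), K satisfying the standing assumptions, ρ ∈ (γ,1), β = 1/(ρ−γ). If H ∈ C([0,T];𝒳_ρ) is a mild solution of the regularized problem with initial datum h₀ ∈ 𝒳_ρ, then H is also a weak solution: for every t ∈ [0,T] and every ψ ∈ C_0^1([0,∞)×[0,t]), ∫ H(X,t)ψ(X,t)dX − ∫ h₀(X)ψ(X,0)dX − ∫_0^t ∫ ∂_sψ(X,s) H(X,s) dX ds = −∫_0^t ∫ ψ(X,s) 𝒜[H](X,s) H(X,s) dX ds + ∫_0^t ∫ ψ(X,s) 𝒬[H](X,s) dX ds. -/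

import Mathlib

open MeasureTheory Real Set Filter Topology

noncomputable section

namespace Smol

/-- Standing assumptions on the coagulation kernel `K`: continuity on `(0,∞)²`, symmetry,
nonnegativity, homogeneity of degree `γ` and the growth bound `K(x,y) ≤ C(x^γ + y^γ)`. -/
structure KernelHyp (K : ℝ → ℝ → ℝ) (γ C : ℝ) : Prop where
  cont : ContinuousOn (fun p : ℝ × ℝ => K p.1 p.2) (Ioi (0:ℝ) ×ˢ Ioi (0:ℝ))
  symm : ∀ x y : ℝ, 0 < x → 0 < y → K x y = K y x
  nonneg : ∀ x y : ℝ, 0 < x → 0 < y → 0 ≤ K x y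
  homog : ∀ a x y : ℝ, 0 < a → 0 < x → 0 < y → K (a * x) (a * y) = a ^ γ * K x y
  growth : ∀ x y : ℝ, 0 < x → 0 < y → K x y ≤ C * (x ^ γ + y ^ γ)

/-- A smooth monotone cutoff `ζ`, vanishing on `[0,1/2]` and equal to `1` on `[1,∞)`. -/
structure CutoffHyp (ζ : ℝ → ℝ) : Prop where
  smooth : ContDiffOn ℝ (⊤ : ℕ∞) ζ (Ici (0:ℝ))
  mono : MonotoneOn ζ (Ici (0:ℝ))
  zero : ∀ s : ℝ, s ≤ 1/2 → ζ s = 0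
  one : ∀ s : ℝ, 1 ≤ s → ζ s = 1

/-- The regularized kernel `K_λ`. -/
def Kreg (K : ℝ → ℝ → ℝ) (ζ : ℝ → ℝ) (lam : ℝ) (y z : ℝ) : ℝ :=
  K y z * ζ (y / lam) * ζ (z / lam) * ζ (y / (lam * (y + z))) * ζ (z / (lam * (y + z)))

/-- Membership in the space `𝒳_ρ` of nonnegative Radon measures on `[0,∞)` with
`sup_{R>0} (∫_{[0,R]} dh)/R^{1-ρ} < ∞`. -/
def MemX (ρ : ℝ) (μ : Measure ℝ) : Prop :=
  μ (Iio 0) = 0 ∧ ∃ M : ℝ, ∀ R > (0:ℝ), μ (Icc 0 R) ≤ ENNReal.ofReal (M * R ^ (1 - ρ))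

/-- The norm `‖h‖_{𝒳_ρ} = sup_{R>0} (∫_{[0,R]} dh)/R^{1-ρ}`, expressed as the least
admissible constant. -/
def Xnorm (ρ : ℝ) (μ : Measure ℝ) : ℝ :=
  sInf {M : ℝ | 0 ≤ M ∧ ∀ R > (0:ℝ), μ (Icc 0 R) ≤ ENNReal.ofReal (M * R ^ (1 - ρ))}

/-- The operator `𝒜[H](X,t) = ∫_0^∞ K_λ(Xe^{-βt},Ze^{-βt})/Z dH(Z,t) - βρ`. -/
def Acal (Kl : ℝ → ℝ → ℝ) (β ρ : ℝ) (H : ℝ → Measure ℝ) (X t : ℝ) : ℝ :=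
  (∫ Z, Kl (X * exp (-(β * t))) (Z * exp (-(β * t))) / Z ∂(H t)) - β * ρ

/-- The measure `𝒬[H](·,t)`, i.e. the weighted convolution
`𝒬[H](X,t) = ∫_0^X (K_λ(Ye^{-βt},(X-Y)e^{-βt})/(X-Y)) H(X-Y,t) dH(Y,t)`. -/
def Qcal (Kl : ℝ → ℝ → ℝ) (β : ℝ) (H : ℝ → Measure ℝ) (t : ℝ) : Measure ℝ :=
  Measure.map (fun p : ℝ × ℝ => p.1 + p.2)
    (((H t).prod (H t)).withDensity fun p =>
      ENNReal.ofReal (Kl (p.1 * exp (-(β * t))) (p.2 * exp (-(β * t))) / p.2))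

/-- Mild solution on `[0,T]` of the regularized problem, in the sense of measures:
`H(·,t) = h₀ e^{-∫_0^t 𝒜[H] ds} + ∫_0^t e^{-∫_s^t 𝒜[H] dξ} 𝒬[H](·,s) ds`,
together with membership in `C([0,T];𝒳_ρ)` (weak continuity in time). -/
def IsMildSolution (Kl : ℝ → ℝ → ℝ) (β ρ T : ℝ) (h0 : Measure ℝ)
    (H : ℝ → Measure ℝ) : Prop :=
  (∀ t ∈ Icc (0:ℝ) T, MemX ρ (H t)) ∧
  (∀ φ : ℝ → ℝ, Continuous φ → HasCompactSupport φ →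
      ContinuousOn (fun t => ∫ X, φ X ∂(H t)) (Icc (0:ℝ) T)) ∧
  (∀ t ∈ Icc (0:ℝ) T, ∀ φ : ℝ → ℝ, Continuous φ → HasCompactSupport φ →
      ∫ X, φ X ∂(H t)
        = (∫ X, φ X * exp (-(∫ s in (0:ℝ)..t, Acal Kl β ρ H X s)) ∂h0)
          + ∫ s in (0:ℝ)..t,
              ∫ X, φ X * exp (-(∫ ξ in s..t, Acal Kl β ρ H X ξ)) ∂(Qcal Kl β H s))

/-- The change of variables producing `h(·,t)` from `H(·,t)`:
`h(x,t) = H(xe^{βt},t)` as densities, i.e. `h(·,t) = e^{-βt}·(X ↦ Xe^{-βt})_*H(·,t)`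
as measures; `S_λ(t)h₀` is `Smap β t (H t)` for the mild solution `H` with datum `h₀`. -/
def Smap (β t : ℝ) (ν : Measure ℝ) : Measure ℝ :=
  ENNReal.ofReal (exp (-(β * t))) • Measure.map (fun X => X * exp (-(β * t))) ν

/-- A family of measures on `ℝ` is vaguely continuous if its integrals against continuous
compactly supported functions depend continuously on the parameter. -/
def VaguelyContinuous {S : Type*} [TopologicalSpace S] (μ : S → Measure ℝ) : Prop :=
  ∀ φ : ℝ → ℝ, Continuous φ → HasCompactSupport φ → Continuous fun s => ∫ x, φ x ∂μ s

theorem hasCompactSupport_of_abs_le {f : ℝ → ℝ} (R : ℝ) (h : ∀ x, R < |x| → f x = 0) :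
    HasCompactSupport f := by
  refine HasCompactSupport.intro (K := Icc (-R) R) isCompact_Icc fun x hx => h x ?_
  by_contra! hc
  exact hx (abs_le.mp hc)

theorem exists_abs_le_of_hasCompactSupport {f : ℝ → ℝ} (hf : HasCompactSupport f) :
    ∃ R, ∀ x, R < |x| → f x = 0 := by
  obtain ⟨R, hR⟩ := hf.isCompact.isBounded.exists_norm_le
  refine ⟨R, fun x hx => ?_⟩
  by_contra hne
  exact absurd (hR x (subset_tsupport _ hne)) (not_le.mpr hx)

theorem integrable_of_abs_le {μ : Measure ℝ} [IsLocallyFiniteMeasure μ] {f : ℝ → ℝ}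
    (hf : Continuous f) (R : ℝ) (h : ∀ x, R < |x| → f x = 0) : Integrable f μ :=
  hf.integrable_of_hasCompactSupport (hasCompactSupport_of_abs_le R h)

theorem exists_cutoff (R : ℝ) : ∃ η : ℝ → ℝ, Continuous η ∧ HasCompactSupport η ∧
    (∀ x, |x| ≤ R → η x = 1) ∧ (∀ x, 0 ≤ η x) := by
  refine ⟨fun x => max 0 (min 1 (R + 1 - |x|)), by fun_prop,
    hasCompactSupport_of_abs_le (R + 1) ?_, ?_, fun x => le_max_left _ _⟩
  · intro x hx
    exact max_eq_left (min_le_of_right_le (by linarith))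
  · intro x hx
    beta_reduce
    rw [min_eq_left (by linarith), max_eq_right zero_le_one]

/-- Vague continuity upgrades to joint continuity for test functions varying with the parameter,
provided their supports are locally uniformly bounded. -/
theorem VaguelyContinuous.continuous_integral {S : Type*} [TopologicalSpace S]
    {μ : S → Measure ℝ} [∀ s, IsLocallyFiniteMeasure (μ s)] (hμ : VaguelyContinuous μ)
    {f : S → ℝ → ℝ} (hf : Continuous fun p : S × ℝ => f p.1 p.2)
    (hsupp : ∀ s₀, ∃ R, ∀ᶠ s in 𝓝 s₀, ∀ x, R < |x| → f s x = 0) :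
    Continuous fun s => ∫ x, f s x ∂μ s := by
  rw [continuous_iff_continuousAt]
  intro s₀
  obtain ⟨R, hR⟩ := hsupp s₀
  obtain ⟨η, hηc, hηs, hη1, hη0⟩ := exists_cutoff R
  have hfs : ∀ s, Continuous (f s) := fun s => hf.comp (Continuous.prodMk_right s)
  have h0 := hR.self_of_nhds
  have hlim : Tendsto (fun s => ∫ x, f s₀ x ∂μ s) (𝓝 s₀) (𝓝 (∫ x, f s₀ x ∂μ s₀)) :=
    (hμ (f s₀) (hfs s₀) (hasCompactSupport_of_abs_le R h0)).continuousAt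
  have hηlim : ∀ᶠ s in 𝓝 s₀, ∫ x, η x ∂μ s < (∫ x, η x ∂μ s₀) + 1 :=
    (hμ η hηc hηs).continuousAt.eventually (gt_mem_nhds (lt_add_one _))
  set B := (∫ x, η x ∂μ s₀) + 1
  have hB : 0 < B := by
    have : 0 ≤ ∫ x, η x ∂μ s₀ := integral_nonneg hη0
    positivity
  have hdiff : Tendsto (fun s => (∫ x, f s x ∂μ s) - ∫ x, f s₀ x ∂μ s) (𝓝 s₀) (𝓝 0) := by
    rw [Metric.tendsto_nhds]
    intro ε hε
    have hδ : 0 < ε / (2 * B) := by positivity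
    have hunif : ∀ᶠ s in 𝓝 s₀, ∀ x ∈ Icc (-R) R, |f s x - f s₀ x| < ε / (2 * B) := by
      refine isCompact_Icc.eventually_forall_of_forall_eventually fun x _ => ?_
      have hc : Continuous fun p : S × ℝ => |f p.1 p.2 - f s₀ p.2| :=
        (hf.sub ((hfs s₀).comp continuous_snd)).abs
      exact hc.continuousAt.eventually (gt_mem_nhds (by simpa using hδ))
    filter_upwards [hR, hηlim, hunif] with s hs1 hs2 hs3
    rw [dist_zero_right, Real.norm_eq_abs,
      ← integral_sub (integrable_of_abs_le (hfs s) R hs1) (integrable_of_abs_le (hfs s₀) R h0)]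
    have hle : ∀ x, ‖f s x - f s₀ x‖ ≤ ε / (2 * B) * η x := by
      intro x
      by_cases hx : R < |x|
      · rw [hs1 x hx, h0 x hx, sub_zero, norm_zero]
        exact mul_nonneg hδ.le (hη0 x)
      · push Not at hx
        rw [hη1 x hx, mul_one]
        exact (hs3 x (abs_le.mp hx)).le
    calc |∫ x, f s x - f s₀ x ∂μ s| ≤ ∫ x, ε / (2 * B) * η x ∂μ s :=
          norm_integral_le_of_norm_le
            ((hηc.integrable_of_hasCompactSupport hηs).const_mul _) (ae_of_all _ hle)
      _ = ε / (2 * B) * ∫ x, η x ∂μ s := integral_const_mul _ _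
      _ ≤ ε / (2 * B) * B := by gcongr
      _ = ε / 2 := by field_simp
      _ < ε := by linarith
  have := hdiff.add hlim
  simpa [ContinuousAt] using this

/-- Fubini on the triangle `0 ≤ s ≤ u ≤ t`. -/
theorem integral_triangle_swap {w : ℝ → ℝ → ℝ} (hw : Continuous fun p : ℝ × ℝ => w p.1 p.2)
    {t : ℝ} (ht : 0 ≤ t) :
    ∫ s in (0:ℝ)..t, ∫ u in s..t, w s u = ∫ u in (0:ℝ)..t, ∫ s in (0:ℝ)..u, w s u := by
  have hint : Integrable (Function.uncurry fun s u => (Ioi s).indicator (w s) u)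
      ((volume.restrict (Ioc 0 t)).prod (volume.restrict (Ioc 0 t))) := by
    have h1 : (Function.uncurry fun s u => (Ioi s).indicator (w s) u)
        = {p : ℝ × ℝ | p.1 < p.2}.indicator fun p => w p.1 p.2 := by
      ext p
      simp [Function.uncurry, indicator]
    rw [h1, Measure.prod_restrict]
    refine Integrable.indicator ?_ (measurableSet_lt measurable_fst measurable_snd)
    exact (hw.continuousOn.integrableOn_compact
      (isCompact_Icc.prod isCompact_Icc)).mono_set (prod_mono Ioc_subset_Icc_self
        Ioc_subset_Icc_self)
  have hswap := integral_integral_swap hint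
  rw [intervalIntegral.integral_of_le ht, intervalIntegral.integral_of_le ht]
  convert hswap using 1
  · refine setIntegral_congr_fun measurableSet_Ioc fun s hs => ?_
    rw [intervalIntegral.integral_of_le hs.2, setIntegral_indicator measurableSet_Ioi]
    congr 2
    ext u
    simp only [mem_Ioc, mem_inter_iff, mem_Ioi]
    exact ⟨fun h => ⟨⟨hs.1.trans h.1, h.2⟩, h.1⟩, fun h => ⟨h.2, h.1.2⟩⟩
  · refine setIntegral_congr_fun measurableSet_Ioc fun u hu => ?_
    have : ∀ s, (Ioi s).indicator (w s) u = (Iio u).indicator (fun s => w s u) s := by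
      intro s
      simp [indicator]
    simp_rw [this]
    rw [intervalIntegral.integral_of_le hu.1.le, setIntegral_indicator measurableSet_Iio,
      integral_Ioc_eq_integral_Ioo]
    congr 2
    ext s
    simp only [mem_Ioo, mem_Ioc, mem_inter_iff, mem_Iio]
    exact ⟨fun h => ⟨⟨h.1, h.2.le.trans hu.2⟩, h.2⟩, fun h => ⟨h.1.1, h.2⟩⟩

theorem integral_intervalIntegral_swap {μ : Measure ℝ} [IsLocallyFiniteMeasure μ]
    {f : ℝ → ℝ → ℝ} (hf : Continuous fun p : ℝ × ℝ => f p.1 p.2) {R : ℝ}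
    (hR : ∀ x u, R < |x| → f x u = 0) {a b : ℝ} (hab : a ≤ b) :
    ∫ x, (∫ u in a..b, f x u) ∂μ = ∫ u in a..b, ∫ x, f x u ∂μ := by
  have hint : Integrable (Function.uncurry f) (μ.prod (volume.restrict (Ioc a b))) := by
    have h1 : IntegrableOn (Function.uncurry f) (Icc (-R) R ×ˢ Icc a b) (μ.prod volume) :=
      ContinuousOn.integrableOn_compact (isCompact_Icc.prod isCompact_Icc) hf.continuousOn
    have h2 : IntegrableOn (Function.uncurry f) (univ ×ˢ Icc a b) (μ.prod volume) := by
      refine h1.of_forall_sdiff_eq_zero (MeasurableSet.univ.prod measurableSet_Icc) ?_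
      rintro ⟨x, u⟩ ⟨h, h'⟩
      refine hR x u ?_
      by_contra! hc
      exact h' ⟨abs_le.mp hc, h.2⟩
    have h3 := h2.mono_set (prod_mono_right (s := univ) (Ioc_subset_Icc_self (a := a) (b := b)))
    rwa [IntegrableOn, ← Measure.prod_restrict, Measure.restrict_univ] at h3
  simp_rw [intervalIntegral.integral_of_le hab]
  exact integral_integral_swap hint

theorem continuous_primitive_between {A : ℝ → ℝ → ℝ}
    (hA : Continuous fun p : ℝ × ℝ => A p.1 p.2) :
    Continuous fun q : ℝ × ℝ × ℝ => ∫ ξ in q.1..q.2.1, A q.2.2 ξ := by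
  have hAX : ∀ X, Continuous (A X) := fun X => hA.comp (Continuous.prodMk_right X)
  have hA' : Continuous (Function.uncurry fun (q : ℝ × ℝ × ℝ) ξ => A q.2.2 ξ) :=
    hA.comp (by fun_prop : Continuous fun r : (ℝ × ℝ × ℝ) × ℝ => (r.1.2.2, r.2))
  have h1 := intervalIntegral.continuous_parametric_intervalIntegral_of_continuous
    (μ := volume) (a₀ := 0) hA' (s := fun q => q.2.1) (by fun_prop)
  have h2 := intervalIntegral.continuous_parametric_intervalIntegral_of_continuous
    (μ := volume) (a₀ := 0) hA' (s := fun q => q.1) (by fun_prop)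
  refine (h1.sub h2).congr fun q => ?_
  exact intervalIntegral.integral_interval_sub_left ((hAX _).intervalIntegrable _ _)
    ((hAX _).intervalIntegrable _ _)

/-- Duhamel's formula implies the weak formulation, for a general continuous rate `A` and a
general vaguely continuous source `Q`. -/
theorem weak_of_duhamel {T : ℝ} {ν Q : ℝ → Measure ℝ} {h0 : Measure ℝ}
    [∀ s, IsLocallyFiniteMeasure (ν s)] [∀ s, IsLocallyFiniteMeasure (Q s)]
    [IsLocallyFiniteMeasure h0] (hν : VaguelyContinuous ν) (hQ : VaguelyContinuous Q)
    {A : ℝ → ℝ → ℝ} (hA : Continuous fun p : ℝ × ℝ => A p.1 p.2)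
    (hmild : ∀ t ∈ Icc (0:ℝ) T, ∀ φ : ℝ → ℝ, Continuous φ → HasCompactSupport φ →
      ∫ X, φ X ∂(ν t) = (∫ X, φ X * exp (-(∫ s in (0:ℝ)..t, A X s)) ∂h0)
        + ∫ s in (0:ℝ)..t, ∫ X, φ X * exp (-(∫ ξ in s..t, A X ξ)) ∂(Q s))
    {t : ℝ} (ht : t ∈ Icc (0:ℝ) T) {ψ : ℝ → ℝ → ℝ}
    (hψ : ContDiff ℝ 1 (fun p : ℝ × ℝ => ψ p.1 p.2))
    (hψs : HasCompactSupport (fun p : ℝ × ℝ => ψ p.1 p.2)) :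
    (∫ X, ψ X t ∂(ν t)) - (∫ X, ψ X 0 ∂h0)
        - (∫ s in (0:ℝ)..t, ∫ X, deriv (fun u => ψ X u) s ∂(ν s))
      = -(∫ s in (0:ℝ)..t, ∫ X, ψ X s * A X s ∂(ν s))
        + ∫ s in (0:ℝ)..t, ∫ X, ψ X s ∂(Q s) := by
  obtain ⟨R, hR⟩ : ∃ R, ∀ X s, R < |X| → ψ X s = 0 := by
    obtain ⟨R, hR⟩ := hψs.isCompact.isBounded.exists_norm_le
    refine ⟨R, fun X s hX => ?_⟩
    by_contra hne
    have := hR (X, s) (subset_tsupport _ hne)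
    exact absurd ((norm_fst_le (X, s)).trans this) (not_le.mpr hX)
  have hψc := hψ.continuous
  have hψd : ∀ X s, HasDerivAt (fun u => ψ X u) (deriv (fun u => ψ X u) s) s := by
    intro X s
    refine DifferentiableAt.hasDerivAt ?_
    exact (hψ.differentiable one_ne_zero (X, s)).comp s
      ((differentiableAt_const X).prodMk differentiableAt_id)
  have hdc : Continuous fun p : ℝ × ℝ => deriv (fun u => ψ p.1 u) p.2 := by
    have h1 : Continuous fun p : ℝ × ℝ =>
        fderiv ℝ (fun p : ℝ × ℝ => ψ p.1 p.2) p ((0 : ℝ), (1 : ℝ)) :=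
      (hψ.continuous_fderiv one_ne_zero).clm_apply continuous_const
    refine h1.congr fun p => ?_
    have h2 := (hψ.differentiable one_ne_zero (p.1, p.2)).hasFDerivAt.comp_hasDerivAt p.2
      ((hasDerivAt_const p.2 p.1).prodMk (hasDerivAt_id p.2))
    exact h2.deriv.symm
  have hd0 : ∀ X s, R < |X| → deriv (fun u => ψ X u) s = 0 := by
    intro X s hX
    have : (fun u => ψ X u) = fun _ => 0 := funext fun u => hR X u hX
    rw [this, deriv_const]
  set E : ℝ → ℝ → ℝ → ℝ := fun s u X => exp (-(∫ ξ in s..u, A X ξ)) with hE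
  have hEc : Continuous fun q : ℝ × ℝ × ℝ => E q.1 q.2.1 q.2.2 :=
    continuous_exp.comp (continuous_primitive_between hA).neg
  set χ : ℝ → ℝ → ℝ := fun X u => deriv (fun u => ψ X u) u - ψ X u * A X u with hχ
  have hχc : Continuous fun p : ℝ × ℝ => χ p.1 p.2 := hdc.sub (hψc.mul hA)
  have hχ0 : ∀ X u, R < |X| → χ X u = 0 := by
    intro X u hX
    simp only [hχ]
    rw [hd0 X u hX, hR X u hX, zero_mul, sub_zero]
  have hgc : ∀ s, Continuous fun p : ℝ × ℝ => χ p.1 p.2 * E s p.2 p.1 := fun s =>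
    hχc.mul (hEc.comp (by fun_prop : Continuous fun p : ℝ × ℝ => (s, p.2, p.1)))
  have hEd : ∀ s X u, HasDerivAt (fun u => ψ X u * E s u X) (χ X u * E s u X) u := by
    intro s X u
    have hAX : Continuous (A X) := hA.comp (Continuous.prodMk_right X)
    have h1 : HasDerivAt (fun u => ∫ ξ in s..u, A X ξ) (A X u) u :=
      hAX.integral_hasStrictDerivAt s u |>.hasDerivAt
    refine ((hψd X u).mul h1.neg.exp).congr_deriv ?_
    simp only [hχ, hE, Pi.neg_apply]
    ring
  have hEint : ∀ s X, ψ X t * E s t X = ψ X s + ∫ u in s..t, χ X u * E s u X := by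
    intro s X
    rw [intervalIntegral.integral_eq_sub_of_hasDerivAt (fun u _ => hEd s X u)
      (((hgc s).comp (Continuous.prodMk_right X)).intervalIntegrable _ _)]
    simp [hE]
  have hIc : ∀ s, Continuous fun X => ∫ u in s..t, χ X u * E s u X := fun s =>
    intervalIntegral.continuous_parametric_intervalIntegral_of_continuous' (hgc s) s t
  have hI0 : ∀ s X, R < |X| → ∫ u in s..t, χ X u * E s u X = 0 := by
    intro s X hX
    simp [hχ0 X _ hX]
  have hψX : ∀ s, Continuous fun X => ψ X s := fun s => hψc.comp (Continuous.prodMk_left s)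
  have hsplit : ∀ (μ : Measure ℝ) [IsLocallyFiniteMeasure μ] (s : ℝ), s ≤ t →
      ∫ X, ψ X t * E s t X ∂μ
        = (∫ X, ψ X s ∂μ) + ∫ u in s..t, ∫ X, χ X u * E s u X ∂μ := by
    intro μ _ s hs
    simp_rw [hEint s]
    rw [integral_add (integrable_of_abs_le (hψX s) R fun X hX => hR X s hX)
      (integrable_of_abs_le (hIc s) R (hI0 s)),
      integral_intervalIntegral_swap (hgc s) (R := R)
        (fun X u hX => by rw [hχ0 X u hX, zero_mul]) hs]
  set w : ℝ → ℝ → ℝ := fun s u => ∫ X, χ X u * E s u X ∂(Q s)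
  have hwc : Continuous fun p : ℝ × ℝ => w p.1 p.2 := by
    have hQ' : VaguelyContinuous fun p : ℝ × ℝ => Q p.1 := fun φ h1 h2 =>
      (hQ φ h1 h2).comp continuous_fst
    refine hQ'.continuous_integral (f := fun p X => χ X p.2 * E p.1 p.2 X) ?_ ?_
    · exact (hχc.comp (by fun_prop : Continuous fun q : (ℝ × ℝ) × ℝ => (q.2, q.1.2))).mul
        (hEc.comp (by fun_prop : Continuous fun q : (ℝ × ℝ) × ℝ => (q.1.1, q.1.2, q.2)))
    · exact fun _ => ⟨R, Eventually.of_forall fun p X hX => by rw [hχ0 X _ hX, zero_mul]⟩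
  have hpair : ∀ {μ : ℝ → Measure ℝ} [∀ s, IsLocallyFiniteMeasure (μ s)] {f : ℝ → ℝ → ℝ},
      VaguelyContinuous μ → (Continuous fun p : ℝ × ℝ => f p.1 p.2) →
      (∀ X s, R < |X| → f X s = 0) → Continuous fun s => ∫ X, f X s ∂(μ s) := by
    intro μ _ f hμ hf hf0
    exact hμ.continuous_integral (f := fun s X => f X s) (hf.comp continuous_swap)
      fun _ => ⟨R, Eventually.of_forall fun s X hX => hf0 X s hX⟩
  have hψA0 : ∀ X s, R < |X| → ψ X s * A X s = 0 := fun X s hX => by rw [hR X s hX, zero_mul]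
  have hcd := hpair hν hdc hd0
  have hcA := hpair (f := fun X s => ψ X s * A X s) hν (hψc.mul hA) hψA0
  have hcQ := hpair hQ hψc hR
  have hwint : Continuous fun s => ∫ u in s..t, w s u := by
    have hw' : Continuous (Function.uncurry w) := hwc
    have h1 := intervalIntegral.continuous_parametric_intervalIntegral_of_continuous
      (μ := volume) (a₀ := t) hw' continuous_id
    refine h1.neg.congr fun s => ?_
    exact (intervalIntegral.integral_symm t s).symm
  have hmildt := hmild t ht (fun X => ψ X t) (hψX t)
    (hasCompactSupport_of_abs_le R fun X hX => hR X t hX)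
  have hstep : ∫ X, ψ X t ∂(ν t) = (∫ X, ψ X 0 ∂h0)
      + (∫ u in (0:ℝ)..t, ∫ X, χ X u * E 0 u X ∂h0)
      + ((∫ s in (0:ℝ)..t, ∫ X, ψ X s ∂(Q s)) + ∫ u in (0:ℝ)..t, ∫ s in (0:ℝ)..u, w s u) := by
    rw [hmildt, ← integral_triangle_swap hwc ht.1,
      ← intervalIntegral.integral_add (hcQ.intervalIntegrable _ _)
        (hwint.intervalIntegrable _ _)]
    congr 1
    · exact hsplit h0 0 ht.1
    · refine intervalIntegral.integral_congr fun s hs => ?_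
      rw [uIcc_of_le ht.1] at hs
      exact hsplit (Q s) s hs.2
  have hχmild : ∀ u ∈ Icc 0 t, (∫ X, χ X u * E 0 u X ∂h0) + (∫ s in (0:ℝ)..u, w s u)
      = (∫ X, deriv (fun u => ψ X u) u ∂(ν u)) - ∫ X, ψ X u * A X u ∂(ν u) := by
    intro u hu
    have hleft : ∀ {f : ℝ → ℝ → ℝ}, (Continuous fun p : ℝ × ℝ => f p.1 p.2) →
        Continuous fun X => f X u := fun hf => hf.comp (Continuous.prodMk_left u)
    rw [← integral_sub
      (integrable_of_abs_le (hleft (f := fun X u => deriv (fun u => ψ X u) u) hdc) R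
        fun X hX => hd0 X u hX)
      (integrable_of_abs_le (hleft (f := fun X u => ψ X u * A X u) (hψc.mul hA)) R
        fun X hX => hψA0 X u hX)]
    exact (hmild u ⟨hu.1, hu.2.trans ht.2⟩ (fun X => χ X u) (hleft hχc)
      (hasCompactSupport_of_abs_le R fun X hX => hχ0 X u hX)).symm
  have hc0 : Continuous fun u => ∫ X, χ X u * E 0 u X ∂h0 :=
    hpair (μ := fun _ => h0) (f := fun X u => χ X u * E 0 u X) (fun φ _ _ => continuous_const)
      (hgc 0) (fun X u hX => by rw [hχ0 X u hX, zero_mul])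
  have hcw : Continuous fun u => ∫ s in (0:ℝ)..u, w s u := by
    have hw' : Continuous (Function.uncurry fun u s => w s u) := hwc.comp continuous_swap
    exact intervalIntegral.continuous_parametric_intervalIntegral_of_continuous
      (μ := volume) (a₀ := 0) hw' continuous_id
  have hsum : (∫ u in (0:ℝ)..t, ∫ X, χ X u * E 0 u X ∂h0)
      + (∫ u in (0:ℝ)..t, ∫ s in (0:ℝ)..u, w s u)
      = (∫ u in (0:ℝ)..t, ∫ X, deriv (fun u => ψ X u) u ∂(ν u))
        - ∫ u in (0:ℝ)..t, ∫ X, ψ X u * A X u ∂(ν u) := by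
    rw [← intervalIntegral.integral_add (hc0.intervalIntegrable _ _)
      (hcw.intervalIntegrable _ _), ← intervalIntegral.integral_sub
      (hcd.intervalIntegrable _ _) (hcA.intervalIntegrable _ _)]
    refine intervalIntegral.integral_congr fun u hu => ?_
    rw [uIcc_of_le ht.1] at hu
    exact hχmild u hu
  rw [hstep]
  linarith

theorem CutoffHyp.continuous {ζ : ℝ → ℝ} (hζ : CutoffHyp ζ) : Continuous ζ := by
  have h : Continuous fun s => ζ (max s 0) :=
    hζ.smooth.continuousOn.comp_continuous (by fun_prop) fun s => le_max_right s 0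
  refine h.congr fun s => ?_
  rcases le_total 0 s with hs | hs
  · rw [max_eq_left hs]
  · rw [max_eq_right hs, hζ.zero 0 (by norm_num), hζ.zero s (by linarith)]

theorem CutoffHyp.nonneg {ζ : ℝ → ℝ} (hζ : CutoffHyp ζ) (s : ℝ) : 0 ≤ ζ s := by
  rcases le_total s (1 / 2) with hs | hs
  · rw [hζ.zero s hs]
  · have h := hζ.mono (show (1 / 2 : ℝ) ∈ Ici 0 by norm_num [mem_Ici])
      (show s ∈ Ici 0 from le_trans (by norm_num) hs) hs
    rwa [hζ.zero _ le_rfl] at h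

theorem Kreg_support {K : ℝ → ℝ → ℝ} {ζ : ℝ → ℝ} {lam y z : ℝ} (hζ : CutoffHyp ζ)
    (hlam : 0 < lam) (h : Kreg K ζ lam y z ≠ 0) :
    lam / 2 < y ∧ lam / 2 < z ∧ z ≤ 2 / lam * y := by
  have hz : ∀ {s}, ζ s ≠ 0 → 1 / 2 < s := fun hs => by
    by_contra! hc
    exact hs (hζ.zero _ hc)
  simp only [Kreg, mul_ne_zero_iff] at h
  obtain ⟨⟨⟨⟨-, h1⟩, h2⟩, h3⟩, -⟩ := h
  have h1 := (lt_div_iff₀ hlam).mp (hz h1)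
  have h2 := (lt_div_iff₀ hlam).mp (hz h2)
  have h3 := (lt_div_iff₀ (mul_pos hlam (by linarith))).mp (hz h3)
  refine ⟨by linarith, by linarith, ?_⟩
  rw [div_mul_eq_mul_div, le_div_iff₀ hlam]
  nlinarith

theorem Kreg_nonneg {K : ℝ → ℝ → ℝ} {ζ : ℝ → ℝ} {γ C lam : ℝ} (hK : KernelHyp K γ C)
    (hζ : CutoffHyp ζ) (hlam : 0 < lam) (y z : ℝ) : 0 ≤ Kreg K ζ lam y z := by
  by_cases h : Kreg K ζ lam y z = 0
  · rw [h]
  · obtain ⟨hy, hz, -⟩ := Kreg_support hζ hlam h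
    have hK0 := hK.nonneg y z (by linarith) (by linarith)
    have := hζ.nonneg
    unfold Kreg
    exact mul_nonneg (mul_nonneg (mul_nonneg (mul_nonneg hK0 (this _)) (this _)) (this _)) (this _)

theorem Kreg_continuous {K : ℝ → ℝ → ℝ} {ζ : ℝ → ℝ} {γ C lam : ℝ} (hK : KernelHyp K γ C)
    (hζ : CutoffHyp ζ) (hlam : 0 < lam) : Continuous fun p : ℝ × ℝ => Kreg K ζ lam p.1 p.2 := by
  have hζc := hζ.continuous
  have h2 : 0 < lam / 2 := by positivity
  have hKc : Continuous fun p : ℝ × ℝ => K (max p.1 (lam / 2)) (max p.2 (lam / 2)) :=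
    hK.cont.comp_continuous
      (by fun_prop : Continuous fun p : ℝ × ℝ => (max p.1 (lam / 2), max p.2 (lam / 2)))
      fun p => ⟨lt_of_lt_of_le h2 (le_max_right _ _), lt_of_lt_of_le h2 (le_max_right _ _)⟩
  have hden : ∀ p : ℝ × ℝ, lam * max (p.1 + p.2) lam ≠ 0 := fun p =>
    (mul_pos hlam (lt_of_lt_of_le hlam (le_max_right _ _))).ne'
  have hd1 : Continuous fun p : ℝ × ℝ => p.1 / (lam * max (p.1 + p.2) lam) :=
    continuous_fst.div (by fun_prop) hden
  have hd2 : Continuous fun p : ℝ × ℝ => p.2 / (lam * max (p.1 + p.2) lam) :=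
    continuous_snd.div (by fun_prop) hden
  have hmain : Continuous fun p : ℝ × ℝ =>
      K (max p.1 (lam / 2)) (max p.2 (lam / 2)) * ζ (p.1 / lam) * ζ (p.2 / lam)
        * ζ (p.1 / (lam * max (p.1 + p.2) lam)) * ζ (p.2 / (lam * max (p.1 + p.2) lam)) :=
    (((hKc.mul (hζc.comp (continuous_fst.div_const lam))).mul
      (hζc.comp (continuous_snd.div_const lam))).mul (hζc.comp hd1)).mul (hζc.comp hd2)
  refine hmain.congr fun p => ?_
  have hz : ∀ {x}, x ≤ lam / 2 → ζ (x / lam) = 0 := fun hx =>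
    hζ.zero _ ((div_le_iff₀ hlam).mpr (by linarith))
  by_cases h1 : p.1 ≤ lam / 2
  · simp [Kreg, hz h1]
  by_cases h2 : p.2 ≤ lam / 2
  · simp [Kreg, hz h2]
  push Not at h1 h2
  rw [max_eq_left h1.le, max_eq_left h2.le, max_eq_left (by linarith), Kreg]

/-- The kernel `K_λ(Xe^{-βs}, Ze^{-βs}) / Z` in self-similar variables. -/
def scaledKernel (Kl : ℝ → ℝ → ℝ) (β s X Z : ℝ) : ℝ :=
  Kl (X * exp (-(β * s))) (Z * exp (-(β * s))) / Z

/-- The properties of the rescaled kernel which make `𝒜` and `𝒬` vaguely continuous in time. -/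
structure LocalKernel (F : ℝ → ℝ → ℝ → ℝ) (L : ℝ) : Prop where
  cont : Continuous fun q : ℝ × ℝ × ℝ => F q.1 q.2.1 q.2.2
  nonneg : ∀ s X Z, 0 ≤ F s X Z
  support : ∀ s X Z, F s X Z ≠ 0 → 0 < X ∧ 0 < Z ∧ Z ≤ L * X

theorem localKernel_scaledKernel {K : ℝ → ℝ → ℝ} {ζ : ℝ → ℝ} {γ C lam : ℝ} (β : ℝ)
    (hK : KernelHyp K γ C) (hζ : CutoffHyp ζ) (hlam : 0 < lam) :
    LocalKernel (scaledKernel (Kreg K ζ lam) β) (2 / lam) := by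
  have hsupp : ∀ s X Z, Kreg K ζ lam (X * exp (-(β * s))) (Z * exp (-(β * s))) ≠ 0 →
      0 < X ∧ 0 < Z ∧ Z ≤ 2 / lam * X := by
    intro s X Z h
    obtain ⟨h1, h2, h3⟩ := Kreg_support hζ hlam h
    have he := exp_pos (-(β * s))
    refine ⟨pos_of_mul_pos_left (lt_trans (by positivity) h1) he.le,
      pos_of_mul_pos_left (lt_trans (by positivity) h2) he.le, ?_⟩
    rw [← mul_assoc] at h3
    exact le_of_mul_le_mul_right h3 he
  refine ⟨?_, ?_, ?_⟩
  · have h2 : 0 < lam / 2 := by positivity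
    have hc : Continuous fun q : ℝ × ℝ × ℝ => exp (-(β * q.1)) *
        (Kreg K ζ lam (q.2.1 * exp (-(β * q.1))) (q.2.2 * exp (-(β * q.1)))
          / max (q.2.2 * exp (-(β * q.1))) (lam / 2)) := by
      refine (by fun_prop : Continuous fun q : ℝ × ℝ × ℝ => exp (-(β * q.1))).mul
        (Continuous.div ?_ (by fun_prop) fun q => (lt_of_lt_of_le h2 (le_max_right _ _)).ne')
      exact (Kreg_continuous hK hζ hlam).comp (by fun_prop : Continuous fun q : ℝ × ℝ × ℝ =>
        (q.2.1 * exp (-(β * q.1)), q.2.2 * exp (-(β * q.1))))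
    refine hc.congr fun q => ?_
    unfold scaledKernel
    by_cases h : Kreg K ζ lam (q.2.1 * exp (-(β * q.1))) (q.2.2 * exp (-(β * q.1))) = 0
    · simp [h]
    · rw [max_eq_left (Kreg_support hζ hlam h).2.1.le]
      have := (hsupp _ _ _ h).2.1.ne'
      have := (exp_pos (-(β * q.1))).ne'
      field_simp
  · intro s X Z
    unfold scaledKernel
    by_cases h : Kreg K ζ lam (X * exp (-(β * s))) (Z * exp (-(β * s))) = 0
    · simp [h]
    · exact div_nonneg (Kreg_nonneg hK hζ hlam _ _) (hsupp _ _ _ h).2.1.le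
  · intro s X Z h
    exact hsupp s X Z (div_ne_zero_iff.mp h).1

namespace LocalKernel

variable {F : ℝ → ℝ → ℝ → ℝ} {L : ℝ}

theorem continuous_loss (hF : LocalKernel F L) (hL : 0 ≤ L) {ν : ℝ → Measure ℝ}
    [∀ s, IsLocallyFiniteMeasure (ν s)] (hν : VaguelyContinuous ν) :
    Continuous fun p : ℝ × ℝ => ∫ Z, F p.2 p.1 Z ∂(ν p.2) := by
  have hν' : VaguelyContinuous fun p : ℝ × ℝ => ν p.2 := fun φ h1 h2 =>
    (hν φ h1 h2).comp continuous_snd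
  refine hν'.continuous_integral (f := fun p Z => F p.2 p.1 Z)
    (hF.cont.comp (by fun_prop : Continuous fun q : (ℝ × ℝ) × ℝ => (q.1.2, q.1.1, q.2))) ?_
  intro p₀
  refine ⟨L * (p₀.1 + 1), ?_⟩
  filter_upwards [continuous_fst.continuousAt.eventually (gt_mem_nhds (lt_add_one p₀.1))]
    with p hp Z hZ
  by_contra h
  obtain ⟨-, h2, h3⟩ := hF.support _ _ _ h
  rw [abs_of_pos h2] at hZ
  have : L * p.1 ≤ L * (p₀.1 + 1) := by gcongr
  linarith

/-- The gain measure: the convolution of `μ` with itself, weighted by `F s`. -/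
def gain (F : ℝ → ℝ → ℝ → ℝ) (s : ℝ) (μ : Measure ℝ) : Measure ℝ :=
  Measure.map (fun p : ℝ × ℝ => p.1 + p.2)
    ((μ.prod μ).withDensity fun p => ENNReal.ofReal (F s p.1 p.2))

theorem mul_eq_zero_of_lt (hF : LocalKernel F L) {φ : ℝ → ℝ} {R : ℝ}
    (hR : ∀ x, R < |x| → φ x = 0) (s Y Z : ℝ) (h : R < |Y| ∨ R < |Z|) :
    F s Y Z * φ (Y + Z) = 0 := by
  by_contra hne
  obtain ⟨hF0, hφ0⟩ := mul_ne_zero_iff.mp hne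
  obtain ⟨hY, hZ, -⟩ := hF.support _ _ _ hF0
  have : |Y + Z| ≤ R := by
    by_contra! hc
    exact hφ0 (hR _ hc)
  rw [abs_of_pos (by linarith)] at this
  rw [abs_of_pos hY, abs_of_pos hZ] at h
  rcases h with h | h <;> linarith

theorem continuous_slice (hF : LocalKernel F L) (s : ℝ) :
    Continuous fun p : ℝ × ℝ => F s p.1 p.2 :=
  hF.cont.comp (by fun_prop : Continuous fun p : ℝ × ℝ => (s, p.1, p.2))

theorem integrable_mul (hF : LocalKernel F L) (s : ℝ) (μ : Measure ℝ)
    [IsLocallyFiniteMeasure μ] {φ : ℝ → ℝ} (hφ : Continuous φ) {R : ℝ}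
    (hR : ∀ x, R < |x| → φ x = 0) :
    Integrable (fun p : ℝ × ℝ => F s p.1 p.2 * φ (p.1 + p.2)) (μ.prod μ) := by
  have hc : Continuous fun p : ℝ × ℝ => F s p.1 p.2 * φ (p.1 + p.2) :=
    (hF.continuous_slice s).mul (hφ.comp (continuous_fst.add continuous_snd))
  refine hc.integrable_of_hasCompactSupport (HasCompactSupport.intro
    (K := Icc (-R) R ×ˢ Icc (-R) R) (isCompact_Icc.prod isCompact_Icc) ?_)
  rintro ⟨Y, Z⟩ h
  refine hF.mul_eq_zero_of_lt hR s Y Z ?_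
  by_contra! hc
  exact h ⟨abs_le.mp hc.1, abs_le.mp hc.2⟩

theorem measurable_density (hF : LocalKernel F L) (s : ℝ) :
    Measurable fun p : ℝ × ℝ => ENNReal.ofReal (F s p.1 p.2) :=
  ENNReal.measurable_ofReal.comp (hF.continuous_slice s).measurable

theorem integral_gain (hF : LocalKernel F L) (s : ℝ) (μ : Measure ℝ)
    [IsLocallyFiniteMeasure μ] {φ : ℝ → ℝ} (hφ : Continuous φ) {R : ℝ}
    (hR : ∀ x, R < |x| → φ x = 0) :
    ∫ x, φ x ∂(gain F s μ) = ∫ Y, ∫ Z, F s Y Z * φ (Y + Z) ∂μ ∂μ := by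
  rw [gain, integral_map (by fun_prop) hφ.aestronglyMeasurable,
    integral_withDensity_eq_integral_toReal_smul (hF.measurable_density s)
      (ae_of_all _ fun _ => ENNReal.ofReal_lt_top)]
  simp_rw [ENNReal.toReal_ofReal (hF.nonneg _ _ _), smul_eq_mul]
  exact integral_prod _ (hF.integrable_mul s μ hφ hR)

theorem isLocallyFiniteMeasure_gain (hF : LocalKernel F L) (s : ℝ) (μ : Measure ℝ)
    [IsLocallyFiniteMeasure μ] : IsLocallyFiniteMeasure (gain F s μ) := by
  refine ⟨fun x => ⟨Ioo (x - 1) (x + 1), Ioo_mem_nhds (by linarith) (by linarith), ?_⟩⟩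
  obtain ⟨η, hηc, hηs, hη1, hη0⟩ := exists_cutoff (|x| + 1)
  obtain ⟨R, hR⟩ := exists_abs_le_of_hasCompactSupport hηs
  have hle : gain F s μ (Ioo (x - 1) (x + 1)) ≤ ∫⁻ y, ENNReal.ofReal (η y) ∂(gain F s μ) := by
    rw [← lintegral_indicator_one measurableSet_Ioo]
    refine lintegral_mono (indicator_le fun y hy => ?_)
    have hy' : |y| ≤ |x| + 1 := by
      have h1 := neg_abs_le x
      have h2 := le_abs_self x
      exact abs_le.mpr ⟨by linarith [hy.1], by linarith [hy.2]⟩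
    simp [hη1 y hy']
  have hηm : Measurable fun y => ENNReal.ofReal (η y) :=
    ENNReal.measurable_ofReal.comp hηc.measurable
  refine hle.trans_lt ?_
  rw [gain, lintegral_map hηm (by fun_prop), lintegral_withDensity_eq_lintegral_mul _
    (hF.measurable_density s) (hηm.fun_comp (by fun_prop))]
  refine lt_of_eq_of_lt (lintegral_congr fun p => ?_)
    (hF.integrable_mul s μ hηc hR).lintegral_lt_top
  exact (ENNReal.ofReal_mul (hF.nonneg _ _ _)).symm

theorem vaguelyContinuous_gain (hF : LocalKernel F L) {ν : ℝ → Measure ℝ}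
    [∀ s, IsLocallyFiniteMeasure (ν s)] (hν : VaguelyContinuous ν) :
    VaguelyContinuous fun s => gain F s (ν s) := by
  intro φ hφ hφs
  obtain ⟨R, hR⟩ := exists_abs_le_of_hasCompactSupport hφs
  simp_rw [hF.integral_gain _ _ hφ hR]
  have hν' : VaguelyContinuous fun p : ℝ × ℝ => ν p.1 := fun φ h1 h2 =>
    (hν φ h1 h2).comp continuous_fst
  have hinner : Continuous fun p : ℝ × ℝ => ∫ Z, F p.1 p.2 Z * φ (p.2 + Z) ∂(ν p.1) := by
    refine hν'.continuous_integral (f := fun p Z => F p.1 p.2 Z * φ (p.2 + Z)) ?_ fun _ =>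
      ⟨R, Eventually.of_forall fun p Z hZ => hF.mul_eq_zero_of_lt hR _ _ _ (Or.inr hZ)⟩
    exact (hF.cont.comp
      (by fun_prop : Continuous fun q : (ℝ × ℝ) × ℝ => (q.1.1, q.1.2, q.2))).mul
      (hφ.comp (by fun_prop))
  refine hν.continuous_integral (f := fun s Y => ∫ Z, F s Y Z * φ (Y + Z) ∂(ν s)) hinner
    fun _ => ⟨R, Eventually.of_forall fun s Y hY => ?_⟩
  simp [hF.mul_eq_zero_of_lt hR s Y _ (Or.inl hY)]

end LocalKernel

theorem MemX.isLocallyFiniteMeasure {ρ : ℝ} {μ : Measure ℝ} (h : MemX ρ μ) :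
    IsLocallyFiniteMeasure μ := by
  obtain ⟨h0, M, hM⟩ := h
  refine ⟨fun x => ⟨Iio (|x| + 1), Iio_mem_nhds (by linarith [le_abs_self x]), ?_⟩⟩
  have hsub : Iio (|x| + 1) ⊆ Iio 0 ∪ Icc 0 (|x| + 1) := fun y hy =>
    (lt_or_ge y 0).imp id fun h => ⟨h, le_of_lt hy⟩
  calc μ (Iio (|x| + 1)) ≤ μ (Iio 0) + μ (Icc 0 (|x| + 1)) :=
        (measure_mono hsub).trans (measure_union_le _ _)
    _ ≤ 0 + ENNReal.ofReal (M * (|x| + 1) ^ (1 - ρ)) := by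
        gcongr
        · exact h0.le
        · exact hM _ (by positivity)
    _ < ⊤ := by simp

/-- A mild solution of the regularized problem is also a weak solution: for every
`t ∈ [0,T]` and every `ψ ∈ C_0^1([0,∞)×[0,t])`,
`∫H(X,t)ψ(X,t)dX - ∫h₀ψ(·,0) - ∫_0^t∫∂_sψ H dX ds
  = -∫_0^t∫ψ 𝒜[H] H dX ds + ∫_0^t∫ψ d𝒬[H] ds`. -/
theorem mild_is_weak_solution
    (γ C ρ β lam T : ℝ) (K : ℝ → ℝ → ℝ) (ζ : ℝ → ℝ)
    (hγ : γ ∈ Ico (0:ℝ) 1) (hC : 0 < C) (hK : KernelHyp K γ C) (hζ : CutoffHyp ζ)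
    (hρ : ρ ∈ Ioo γ 1) (hβ : β = 1 / (ρ - γ)) (hlam : lam ∈ Ioo (0:ℝ) (1/2)) (hT : 0 < T)
    (h0 : Measure ℝ) (hh0 : MemX ρ h0)
    (H : ℝ → Measure ℝ) (hH : IsMildSolution (Kreg K ζ lam) β ρ T h0 H) :
    ∀ t ∈ Icc (0:ℝ) T, ∀ ψ : ℝ → ℝ → ℝ,
      ContDiff ℝ 1 (fun p : ℝ × ℝ => ψ p.1 p.2) →
      HasCompactSupport (fun p : ℝ × ℝ => ψ p.1 p.2) →
      (∫ X, ψ X t ∂(H t)) - (∫ X, ψ X 0 ∂h0)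
          - (∫ s in (0:ℝ)..t, ∫ X, deriv (fun u => ψ X u) s ∂(H s))
        = -(∫ s in (0:ℝ)..t, ∫ X, ψ X s * Acal (Kreg K ζ lam) β ρ H X s ∂(H s))
          + ∫ s in (0:ℝ)..t, ∫ X, ψ X s ∂(Qcal (Kreg K ζ lam) β H s) := by
  obtain ⟨hX, hcont, hmild⟩ := hH
  have hF := localKernel_scaledKernel β hK hζ hlam.1
  set F := scaledKernel (Kreg K ζ lam) β
  set pr : ℝ → ℝ := fun s => projIcc 0 T hT.le s with hpr
  have hprmem : ∀ s, pr s ∈ Icc (0:ℝ) T := fun s => (projIcc 0 T hT.le s).2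
  have hprid : ∀ s ∈ Icc (0:ℝ) T, pr s = s := fun s hs => by
    simp only [hpr, projIcc_of_mem hT.le hs]
  have hprc : Continuous pr := continuous_subtype_val.comp continuous_projIcc
  set ν : ℝ → Measure ℝ := fun s => H (pr s) with hνdef
  have : IsLocallyFiniteMeasure h0 := hh0.isLocallyFiniteMeasure
  have : ∀ s, IsLocallyFiniteMeasure (ν s) := fun s => (hX _ (hprmem s)).isLocallyFiniteMeasure
  have : ∀ s, IsLocallyFiniteMeasure (LocalKernel.gain F s (ν s)) := fun s =>
    hF.isLocallyFiniteMeasure_gain s (ν s)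
  have hν : VaguelyContinuous ν := fun φ h1 h2 => (hcont φ h1 h2).comp_continuous hprc hprmem
  set A : ℝ → ℝ → ℝ := fun X s => (∫ Z, F s X Z ∂(ν s)) - β * ρ with hAdef
  have hA : Continuous fun p : ℝ × ℝ => A p.1 p.2 :=
    (hF.continuous_loss (div_nonneg zero_le_two hlam.1.le) hν).sub continuous_const
  have hνH : ∀ s ∈ Icc (0:ℝ) T, ν s = H s := fun s hs => by simp only [hνdef, hprid s hs]
  have hAH : ∀ s ∈ Icc (0:ℝ) T, ∀ X, Acal (Kreg K ζ lam) β ρ H X s = A X s := fun s hs X => by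
    simp only [hAdef, hνH s hs]
    rfl
  have hQH : ∀ s ∈ Icc (0:ℝ) T,
      Qcal (Kreg K ζ lam) β H s = LocalKernel.gain F s (ν s) := fun s hs => by
    rw [hνH s hs]
    rfl
  have hAint : ∀ s ∈ Icc (0:ℝ) T, ∀ u ∈ Icc (0:ℝ) T, ∀ X,
      ∫ ξ in s..u, Acal (Kreg K ζ lam) β ρ H X ξ = ∫ ξ in s..u, A X ξ := fun s hs u hu X =>
    intervalIntegral.integral_congr fun ξ hξ => hAH ξ (uIcc_subset_Icc hs hu hξ) X
  have h0T : (0:ℝ) ∈ Icc (0:ℝ) T := ⟨le_rfl, hT.le⟩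
  intro t ht ψ hψ hψs
  have hsub : uIcc 0 t ⊆ Icc 0 T := uIcc_subset_Icc h0T ht
  have hweak := weak_of_duhamel hν (hF.vaguelyContinuous_gain hν) hA (h0 := h0) (T := T)
    (by
      intro u hu φ hφ hφs
      rw [hνH u hu, hmild u hu φ hφ hφs]
      congr 1
      · simp_rw [hAint 0 h0T u hu]
      · refine intervalIntegral.integral_congr fun s hs => ?_
        have hs' := uIcc_subset_Icc h0T hu hs
        simp only [hQH s hs', hAint s hs' u hu]) ht hψ hψs
  rw [hνH t ht] at hweak
  convert hweak using 2
  · refine intervalIntegral.integral_congr fun s hs => ?_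
    simp only [hνH s (hsub hs)]
  · refine congrArg Neg.neg (intervalIntegral.integral_congr fun s hs => ?_)
    simp only [hνH s (hsub hs), hAH s (hsub hs)]
  · refine intervalIntegral.integral_congr fun s hs => ?_
    simp only [hQH s (hsub hs)]

end Smol
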